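/- Suppose the highest root θ of the simple Lie algebra g is a fundamental weight, and let α̃ be the unique simple root with (θ, α̃) ≠ 0. Then α̃(x_K) = -1 and (θ - α̃)(x_K) = 2. In particular, the cascade element x_K ∈ t is not dominant. -/

import Mathlib

open scoped RealInnerProductSpace

attribute [local instance] Classical.propDecidable

section RootCombinatorics

variable {V : Type*} [NormedAddCommGroup V] [InnerProductSpace ℝ V]

/-- The Cartan pairing `⟨γ, α∨⟩ = 2 (γ, α) / (α, α)`. -/
noncomputable def cartanPairing (γ α : V) : ℝ := 2 * ⟪γ, α⟫ / ⟪α, α⟫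

/-- The coroot `γ∨ = 2 γ / (γ, γ)`. -/
noncomputable def covec (γ : V) : V := (2 / ⟪γ, γ⟫) • γ

/-- The cascade element `x_K = Σ_{β ∈ K} β / (β, β) = ½ Σ_{β ∈ K} β∨`. -/
noncomputable def cascElt (K : Finset V) : V := ∑ β ∈ K, (⟪β, β⟫)⁻¹ • β

/-- The roots of `S` orthogonal to `β`. -/
noncomputable def orthSub (S : Finset V) (β : V) : Finset V := S.filter fun γ => ⟪γ, β⟫ = 0

/-- One step of the non-orthogonality (connectedness) relation inside `S`. -/
def connRel (S : Finset V) (a b : V) : Prop := a ∈ S ∧ b ∈ S ∧ ⟪a, b⟫ ≠ 0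

/-- The irreducible component of the root subsystem `S` containing `γ`. -/
noncomputable def component (S : Finset V) (γ : V) : Finset V :=
  S.filter fun γ' => Relation.ReflTransGen (connRel S) γ γ'

/-- `C` is an irreducible component of the root subsystem `S`. -/
def IsComponent (S C : Finset V) : Prop := ∃ γ ∈ S, C = component S γ

end RootCombinatorics

/-- The combinatorial data of an irreducible crystallographic root system with a chosen
system of positive roots, base (set of simple roots) and highest root: the combinatorial
skeleton of a finite-dimensional complex simple Lie algebra, with the Killing-form
identification of the Cartan subalgebra and its dual. -/
structure RootSystemCtx (V : Type*) [NormedAddCommGroup V] [InnerProductSpace ℝ V] where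
  /-- the set of roots Δ -/
  Δ : Finset V
  /-- the set of simple roots Π -/
  base : Finset V
  /-- the set of positive roots Δ⁺ -/
  Pos : Finset V
  /-- the highest root θ -/
  θ : V
  zero_not_mem : (0 : V) ∉ Δ
  neg_mem : ∀ γ ∈ Δ, -γ ∈ Δ
  reflect_mem : ∀ α ∈ Δ, ∀ γ ∈ Δ, γ - cartanPairing γ α • α ∈ Δ
  pairing_int : ∀ α ∈ Δ, ∀ γ ∈ Δ, ∃ k : ℤ, cartanPairing γ α = (k : ℝ)
  span_eq : Submodule.span ℝ (Δ : Set V) = ⊤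
  base_subset : base ⊆ Pos
  base_indep : LinearIndependent ℝ (fun a : {x // x ∈ base} => (a : V))
  pos_subset : Pos ⊆ Δ
  pos_or_neg : ∀ γ ∈ Δ, γ ∈ Pos ∨ -γ ∈ Pos
  pos_not_neg : ∀ γ ∈ Pos, -γ ∉ Pos
  pos_coords : ∀ γ ∈ Pos, γ ∈ AddSubmonoid.closure (base : Set V)
  irreducible : ∀ S : Finset V, S ⊆ Δ → S.Nonempty →
    (∀ a ∈ S, ∀ b ∈ Δ, b ∉ S → ⟪a, b⟫ = 0) → S = Δ
  theta_mem : θ ∈ Pos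
  theta_highest : ∀ γ ∈ Δ, θ - γ ∈ AddSubmonoid.closure (base : Set V)

namespace RootSystemCtx

variable {V : Type*} [NormedAddCommGroup V] [InnerProductSpace ℝ V]

variable (ctx : RootSystemCtx V)

/-- The root order `γ ≼ γ'` on roots: `γ' - γ` is a nonnegative integral combination of
simple roots. -/
def rootLE (γ γ' : V) : Prop := γ' - γ ∈ AddSubmonoid.closure (ctx.base : Set V)

/-- `β` is the highest root of the root subsystem `S` (with respect to the ambient positive
system). -/
def IsHighest (S : Finset V) (β : V) : Prop :=
  β ∈ S ∧ β ∈ ctx.Pos ∧ ∀ γ ∈ S, ctx.rootLE γ β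

/-- `CascadeMem ctx S β` : the pair (root subsystem `S = Δ⟨i⟩`, its highest root `β = βᵢ`)
occurs in the recursive construction of the Kostant cascade: one starts with `(Δ, θ)`, and the
descendants of `(S, β)` are the pairs `(C, β')` where `C` is an irreducible component of
`{γ ∈ S | (γ, β) = 0}` and `β'` is the highest root of `C`. -/
inductive CascadeMem : Finset V → V → Prop
  | top : CascadeMem ctx.Δ ctx.θ
  | step {S C : Finset V} {β β' : V} : CascadeMem S β →
      IsComponent (orthSub S β) C → ctx.IsHighest C β' → CascadeMem C β'

/-- `K` is the Kostant cascade of the root system. -/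
def IsCascade (K : Finset V) : Prop := ∀ β, β ∈ K ↔ ∃ S, ctx.CascadeMem S β

/-- The Heisenberg subset `H_β = {γ ∈ S ∩ Δ⁺ : (γ, β) > 0}` attached to a cascade pair
`(S, β)`. -/
noncomputable def heis (S : Finset V) (β : V) : Finset V :=
  S.filter fun γ => γ ∈ ctx.Pos ∧ 0 < ⟪γ, β⟫

/-- A root is long if it has the same length as the highest root. -/
def IsLong (γ : V) : Prop := ⟪γ, γ⟫ = ⟪ctx.θ, ctx.θ⟫

/-- The highest root `θ` is a fundamental weight. -/
def ThetaFundamental : Prop :=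
  ∃ α ∈ ctx.base, cartanPairing ctx.θ α = 1 ∧
    ∀ β ∈ ctx.base, β ≠ α → cartanPairing ctx.θ β = 0

/-- `β'` is a descendant of the cascade element `β`. -/
def Desc (β β' : V) : Prop :=
  ∃ S C, ctx.CascadeMem S β ∧ IsComponent (orthSub S β) C ∧ ctx.IsHighest C β'

/-- The cascade poset order: `β ≤ β'` iff `β` is an iterated descendant of `β'`. -/
def cascLE (β β' : V) : Prop := Relation.ReflTransGen (fun a b => ctx.Desc b a) β β'

/-- A simple reflection of the root system. -/
def IsSimpleReflection (w : V ≃ₗ[ℝ] V) : Prop :=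
  ∃ α ∈ ctx.base, ∀ v, w v = v - (2 * ⟪v, α⟫ / ⟪α, α⟫) • α

/-- The Weyl group, generated by the simple reflections. -/
def weylGroup : Subgroup (V ≃ₗ[ℝ] V) := Subgroup.closure {w | ctx.IsSimpleReflection w}

/-- The length of a Weyl group element: the minimal number of simple reflections needed to
express it. -/
noncomputable def length (w : V ≃ₗ[ℝ] V) : ℕ :=
  sInf {n | ∃ l : List (V ≃ₗ[ℝ] V), l.length = n ∧
    (∀ s ∈ l, ctx.IsSimpleReflection s) ∧ l.prod = w}

/-- The root system is of type `Aₙ` (Cartan matrix characterisation). -/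
def IsTypeA (n : ℕ) : Prop :=
  1 ≤ n ∧ ∃ e : Fin n ≃ {x // x ∈ ctx.base}, ∀ i j : Fin n,
    cartanPairing (e i : V) (e j : V) =
      (if i = j then 2 else if i.val + 1 = j.val ∨ j.val + 1 = i.val then -1 else 0)

/-- The root system is of type `Bₙ` (`n ≥ 2`), with the last simple root short. -/
def IsTypeB (n : ℕ) : Prop :=
  2 ≤ n ∧ ∃ e : Fin n ≃ {x // x ∈ ctx.base}, ∀ i j : Fin n,
    cartanPairing (e i : V) (e j : V) =
      (if i = j then 2
       else if i.val + 2 = n ∧ j.val + 1 = n then -2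
       else if i.val + 1 = j.val ∨ j.val + 1 = i.val then -1 else 0)

/-- The root system is of type `Cₙ` (`n ≥ 2`), with the last simple root long. -/
def IsTypeC (n : ℕ) : Prop :=
  2 ≤ n ∧ ∃ e : Fin n ≃ {x // x ∈ ctx.base}, ∀ i j : Fin n,
    cartanPairing (e i : V) (e j : V) =
      (if i = j then 2
       else if i.val + 1 = n ∧ j.val + 2 = n then -2
       else if i.val + 1 = j.val ∨ j.val + 1 = i.val then -1 else 0)

/-- The root system is of type `G₂` (first simple root short). -/
def IsTypeG2 : Prop :=
  ∃ e : Fin 2 ≃ {x // x ∈ ctx.base},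
    cartanPairing (e 0 : V) (e 0 : V) = 2 ∧ cartanPairing (e 1 : V) (e 1 : V) = 2 ∧
    cartanPairing (e 0 : V) (e 1 : V) = -1 ∧ cartanPairing (e 1 : V) (e 0 : V) = -3

/-- The set of roots `Δ(a_z) = w(Δ⁺_z(-1)) ∪ w(-Δ⁺_z(2))` of the abelian ideal attached by
Kostant's construction to `z` (with `w = w_z`). -/
def idealSet (w : V ≃ₗ[ℝ] V) (x : V) : Set V :=
  {δ | ∃ γ ∈ ctx.Pos, (⟪γ, x⟫ = -1 ∧ δ = w γ) ∨ (⟪γ, x⟫ = 2 ∧ δ = -(w γ))}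

end RootSystemCtx

section Subsystem

variable {V : Type*} [NormedAddCommGroup V] [InnerProductSpace ℝ V]

/-- The reflection `s_α γ`. -/
noncomputable def rootReflection (α γ : V) : V := γ - cartanPairing γ α • α

theorem cartanPairing_mul_inner_self {α : V} (hα : α ≠ 0) (γ : V) :
    cartanPairing γ α * ⟪α, α⟫ = 2 * ⟪γ, α⟫ :=
  div_mul_cancel₀ _ (inner_self_ne_zero.mpr hα)

theorem inner_rootReflection_self {α : V} (hα : α ≠ 0) (γ : V) :
    ⟪rootReflection α γ, α⟫ = -⟪γ, α⟫ := by
  rw [rootReflection, inner_sub_left, real_inner_smul_left, cartanPairing_mul_inner_self hα]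
  ring

theorem rootReflection_of_inner_eq_zero {α γ : V} (h : ⟪γ, α⟫ = 0) :
    rootReflection α γ = γ := by
  simp [rootReflection, cartanPairing, h]

theorem connRel_symm {S : Finset V} {a b : V} (h : connRel S a b) : connRel S b a :=
  ⟨h.2.1, h.1, by rw [real_inner_comm]; exact h.2.2⟩

theorem reflTransGen_connRel_symm {S : Finset V} {a b : V}
    (h : Relation.ReflTransGen (connRel S) a b) : Relation.ReflTransGen (connRel S) b a :=
  have : Std.Symm (connRel S) := ⟨fun _ _ => connRel_symm⟩
  symm h

theorem mem_component {S : Finset V} {a b : V} :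
    b ∈ component S a ↔ b ∈ S ∧ Relation.ReflTransGen (connRel S) a b :=
  Finset.mem_filter

theorem mem_orthSub {S : Finset V} {β γ : V} : γ ∈ orthSub S β ↔ γ ∈ S ∧ ⟪γ, β⟫ = 0 :=
  Finset.mem_filter

theorem IsComponent.subset {S C : Finset V} (h : IsComponent S C) : C ⊆ S := by
  obtain ⟨γ, -, rfl⟩ := h
  exact Finset.filter_subset _ _

theorem IsComponent.mem_of_inner_ne_zero {S C : Finset V} (h : IsComponent S C) {a b : V}
    (ha : a ∈ C) (hb : b ∈ S) (hab : ⟪a, b⟫ ≠ 0) : b ∈ C := by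
  obtain ⟨γ, -, rfl⟩ := h
  rw [mem_component] at ha ⊢
  exact ⟨hb, ha.2.tail ⟨ha.1, hb, hab⟩⟩

theorem IsComponent.reflTransGen {S C : Finset V} (h : IsComponent S C) {a b : V}
    (ha : a ∈ C) (hb : b ∈ C) : Relation.ReflTransGen (connRel S) a b := by
  obtain ⟨γ, -, rfl⟩ := h
  rw [mem_component] at ha hb
  exact (reflTransGen_connRel_symm ha.2).trans hb.2

theorem IsComponent.eq_or_orthogonal {S C C' : Finset V} (h : IsComponent S C)
    (h' : IsComponent S C') : C = C' ∨ ∀ a ∈ C, ∀ b ∈ C', ⟪a, b⟫ = 0 := by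
  refine or_iff_not_imp_right.mpr fun hne => ?_
  push Not at hne
  obtain ⟨a, ha, b, hb, hab⟩ := hne
  have hbC := h.mem_of_inner_ne_zero ha (h'.subset hb) hab
  obtain ⟨γ, -, rfl⟩ := h
  obtain ⟨γ', -, rfl⟩ := h'
  rw [mem_component] at hb hbC
  have hγ : Relation.ReflTransGen (connRel S) γ γ' :=
    hbC.2.trans (reflTransGen_connRel_symm hb.2)
  ext c
  rw [mem_component, mem_component]
  exact ⟨fun hc => ⟨hc.1, (reflTransGen_connRel_symm hγ).trans hc.2⟩,
    fun hc => ⟨hc.1, hγ.trans hc.2⟩⟩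

/-- A finite set of nonzero vectors stable under negation and under its own reflections. -/
structure IsReflectionClosed (S : Finset V) : Prop where
  ne_zero : ∀ γ ∈ S, γ ≠ 0
  neg_mem : ∀ γ ∈ S, -γ ∈ S
  reflection_mem : ∀ α ∈ S, ∀ γ ∈ S, rootReflection α γ ∈ S

theorem IsReflectionClosed.orthSub {S : Finset V} (h : IsReflectionClosed S) (β : V) :
    IsReflectionClosed (orthSub S β) where
  ne_zero γ hγ := h.ne_zero γ (mem_orthSub.mp hγ).1
  neg_mem γ hγ := by
    rw [mem_orthSub] at hγ ⊢
    exact ⟨h.neg_mem γ hγ.1, by rw [inner_neg_left, hγ.2, neg_zero]⟩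
  reflection_mem α hα γ hγ := by
    rw [mem_orthSub] at hα hγ ⊢
    refine ⟨h.reflection_mem α hα.1 γ hγ.1, ?_⟩
    rw [rootReflection, inner_sub_left, real_inner_smul_left, hα.2, hγ.2, mul_zero, sub_zero]

theorem IsReflectionClosed.of_isComponent {S C : Finset V} (h : IsReflectionClosed S)
    (hC : IsComponent S C) : IsReflectionClosed C where
  ne_zero γ hγ := h.ne_zero γ (hC.subset hγ)
  neg_mem γ hγ := by
    refine hC.mem_of_inner_ne_zero hγ (h.neg_mem γ (hC.subset hγ)) ?_
    rw [inner_neg_right, neg_ne_zero]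
    exact inner_self_ne_zero.mpr (h.ne_zero γ (hC.subset hγ))
  reflection_mem α hα γ hγ := by
    by_cases h0 : ⟪γ, α⟫ = 0
    · rwa [rootReflection_of_inner_eq_zero h0]
    · refine hC.mem_of_inner_ne_zero hα
        (h.reflection_mem α (hC.subset hα) γ (hC.subset hγ)) ?_
      rw [real_inner_comm, inner_rootReflection_self (h.ne_zero α (hC.subset hα)), neg_ne_zero]
      exact h0

/-- In a reflection-closed set, connected elements have a common non-orthogonal neighbour. -/
theorem IsReflectionClosed.exists_common_neighbour {S : Finset V} (h : IsReflectionClosed S)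
    {μ ν : V} (hμ : μ ∈ S) (hν : Relation.ReflTransGen (connRel S) μ ν) :
    ∃ δ ∈ S, ⟪δ, μ⟫ ≠ 0 ∧ ⟪δ, ν⟫ ≠ 0 := by
  induction hν with
  | refl =>
    have := inner_self_ne_zero (𝕜 := ℝ).mpr (h.ne_zero μ hμ)
    exact ⟨μ, hμ, this, this⟩
  | @tail γ γ' _ hstep ih =>
    obtain ⟨δ, hδ, hδμ, hδγ⟩ := ih
    obtain ⟨hγ, -, hγγ'⟩ := hstep
    by_cases h1 : ⟪δ, γ'⟫ = 0
    · by_cases h2 : ⟪γ, μ⟫ = 0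
      · refine ⟨rootReflection γ δ, h.reflection_mem γ hγ δ hδ, ?_, ?_⟩
        · rwa [rootReflection, inner_sub_left, real_inner_smul_left, h2, mul_zero, sub_zero]
        · rw [rootReflection, inner_sub_left, real_inner_smul_left, h1, zero_sub, neg_ne_zero]
          exact mul_ne_zero (div_ne_zero (mul_ne_zero two_ne_zero hδγ)
            (inner_self_ne_zero.mpr (h.ne_zero γ hγ))) hγγ'
      · exact ⟨γ, hγ, h2, hγγ'⟩
    · exact ⟨δ, hδ, hδμ, h1⟩

/-- Subtracting the projections onto pairwise orthogonal members of a reflection-closed set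
twice stays in that set; vectors orthogonal to the set do not contribute. -/
theorem IsReflectionClosed.sub_sum_mem {S K : Finset V} (h : IsReflectionClosed S)
    (hK : ∀ β ∈ K, ∀ β' ∈ K, β ≠ β' → ⟪β, β'⟫ = 0)
    (hKS : ∀ β ∈ K, β ∈ S ∨ ∀ γ ∈ S, ⟪γ, β⟫ = 0) {γ : V} (hγ : γ ∈ S) :
    γ - ∑ β ∈ K, cartanPairing γ β • β ∈ S := by
  induction K using Finset.induction_on with
  | empty => simpa using hγ
  | insert b K hb ih =>
    have ih' := ih
      (fun β hβ β' hβ' => hK β (Finset.mem_insert_of_mem hβ) β' (Finset.mem_insert_of_mem hβ'))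
      (fun β hβ => hKS β (Finset.mem_insert_of_mem hβ))
    set δ := γ - ∑ β ∈ K, cartanPairing γ β • β with hδ
    have hinner : ⟪δ, b⟫ = ⟪γ, b⟫ := by
      rw [hδ, inner_sub_left, sum_inner, Finset.sum_eq_zero, sub_zero]
      intro β hβ
      rw [real_inner_smul_left, hK β (Finset.mem_insert_of_mem hβ) b (Finset.mem_insert_self _ _)
        (fun e => hb (e ▸ hβ)), mul_zero]
    have hrefl : rootReflection b δ = γ - ∑ β ∈ insert b K, cartanPairing γ β • β := by
      rw [Finset.sum_insert hb, rootReflection, cartanPairing, hinner, ← cartanPairing, hδ]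
      abel
    rw [← hrefl]
    rcases hKS b (Finset.mem_insert_self _ _) with hbS | hbS
    · exact h.reflection_mem b hbS δ ih'
    · rwa [rootReflection_of_inner_eq_zero (hbS δ ih')]

end Subsystem

namespace RootSystemCtx

variable {V : Type*} [NormedAddCommGroup V] [InnerProductSpace ℝ V] (ctx : RootSystemCtx V)

theorem isReflectionClosed : IsReflectionClosed ctx.Δ where
  ne_zero _ hγ h0 := ctx.zero_not_mem (h0 ▸ hγ)
  neg_mem := ctx.neg_mem
  reflection_mem := ctx.reflect_mem

theorem exists_height : ∃ f : V →ₗ[ℝ] ℝ, ∀ α ∈ ctx.base, f α = 1 := by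
  obtain ⟨f, hf⟩ := LinearMap.exists_extend
    ((Module.Basis.span ctx.base_indep).constr ℝ (fun _ => (1 : ℝ)))
  refine ⟨f, fun α hα => ?_⟩
  have h := (Module.Basis.span ctx.base_indep).constr_basis ℝ (fun _ => (1 : ℝ)) ⟨α, hα⟩
  rw [← hf, LinearMap.comp_apply, Submodule.subtype_apply, Module.Basis.span_apply] at h
  exact h

/-- The height function, equal to `1` on every simple root. -/
noncomputable def height : V →ₗ[ℝ] ℝ := ctx.exists_height.choose

theorem height_base {α : V} (hα : α ∈ ctx.base) : ctx.height α = 1 :=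
  ctx.exists_height.choose_spec α hα

theorem eq_zero_or_height_pos {v : V} (hv : v ∈ AddSubmonoid.closure (ctx.base : Set V)) :
    v = 0 ∨ 0 < ctx.height v := by
  induction hv using AddSubmonoid.closure_induction with
  | mem x hx => exact Or.inr (by rw [ctx.height_base hx]; exact one_pos)
  | zero => exact Or.inl rfl
  | add x y _ _ hx hy =>
    rcases hx with rfl | hx
    · simpa using hy
    · rcases hy with rfl | hy
      · simpa using Or.inr hx
      · exact Or.inr (by rw [map_add]; exact add_pos hx hy)

theorem height_nonneg {v : V} (hv : v ∈ AddSubmonoid.closure (ctx.base : Set V)) :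
    0 ≤ ctx.height v := by
  rcases ctx.eq_zero_or_height_pos hv with rfl | h
  · simp
  · exact h.le

theorem eq_zero_of_neg_mem_closure {v : V} (hv : v ∈ AddSubmonoid.closure (ctx.base : Set V))
    (hv' : -v ∈ AddSubmonoid.closure (ctx.base : Set V)) : v = 0 := by
  have h := ctx.height_nonneg hv'
  rw [map_neg] at h
  exact (ctx.eq_zero_or_height_pos hv).resolve_right (by linarith)

theorem rootLE_antisymm {μ ν : V} (h : ctx.rootLE μ ν) (h' : ctx.rootLE ν μ) : μ = ν := by
  refine (sub_eq_zero.mp (ctx.eq_zero_of_neg_mem_closure h ?_)).symm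
  rw [neg_sub]
  exact h'

theorem IsHighest.unique {ctx : RootSystemCtx V} {S : Finset V} {β β' : V}
    (h : ctx.IsHighest S β) (h' : ctx.IsHighest S β') : β = β' :=
  ctx.rootLE_antisymm (h'.2.2 β h.1) (h.2.2 β' h'.1)

theorem ne_zero_of_mem_pos {γ : V} (hγ : γ ∈ ctx.Pos) : γ ≠ 0 :=
  ctx.isReflectionClosed.ne_zero γ (ctx.pos_subset hγ)

theorem natCast_smul_mem_closure (k : ℕ) {γ : V}
    (hγ : γ ∈ AddSubmonoid.closure (ctx.base : Set V)) :
    (k : ℝ) • γ ∈ AddSubmonoid.closure (ctx.base : Set V) := by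
  rw [Nat.cast_smul_eq_nsmul]
  exact AddSubmonoid.nsmul_mem _ hγ k

/-- A negative inner product of roots gives a positive integer `k` with `s_γ μ = μ + k γ`. -/
theorem exists_reflection_eq_add {γ μ : V} (hγ : γ ∈ ctx.Δ) (hμ : μ ∈ ctx.Δ)
    (hneg : ⟪μ, γ⟫ < 0) : ∃ k : ℕ, 0 < k ∧ rootReflection γ μ = μ + (k : ℝ) • γ := by
  obtain ⟨k, hk⟩ := ctx.pairing_int γ hγ μ hμ
  have hpos : 0 < ⟪γ, γ⟫ := real_inner_self_pos.mpr (ctx.isReflectionClosed.ne_zero γ hγ)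
  have hk0 : (k : ℝ) < 0 := by
    rw [← hk, cartanPairing]
    exact div_neg_of_neg_of_pos (by linarith) hpos
  have hk0' : k < 0 := by exact_mod_cast hk0
  obtain ⟨n, rfl⟩ : ∃ n : ℕ, k = -(n : ℤ) := ⟨k.natAbs, by omega⟩
  refine ⟨n, by omega, ?_⟩
  rw [rootReflection, hk]
  push_cast
  rw [neg_smul, sub_neg_eq_add]

/-- `μ` is maximal in `S` for the root order. -/
def IsMaximalIn (S : Finset V) (μ : V) : Prop :=
  μ ∈ S ∧ ∀ ν ∈ S, ctx.rootLE μ ν → ν = μ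

variable {ctx}

theorem IsHighest.isMaximalIn {S : Finset V} {β : V} (h : ctx.IsHighest S β) :
    ctx.IsMaximalIn S β :=
  ⟨h.1, fun ν hν hle => ctx.rootLE_antisymm (h.2.2 ν hν) hle⟩

theorem IsMaximalIn.inner_nonneg {S : Finset V} (hS : IsReflectionClosed S) (hSΔ : S ⊆ ctx.Δ)
    {μ : V} (hμ : ctx.IsMaximalIn S μ) {γ : V} (hγ : γ ∈ S) (hγpos : γ ∈ ctx.Pos) :
    0 ≤ ⟪μ, γ⟫ := by
  by_contra! hneg
  obtain ⟨k, hk, hrefl⟩ := ctx.exists_reflection_eq_add (hSΔ hγ) (hSΔ hμ.1) hneg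
  have hmem := hS.reflection_mem γ hγ μ hμ.1
  rw [hrefl] at hmem
  have hle : ctx.rootLE μ (μ + (k : ℝ) • γ) := by
    rw [rootLE, add_sub_cancel_left]
    exact ctx.natCast_smul_mem_closure k (ctx.pos_coords γ hγpos)
  have h0 := hμ.2 _ hmem hle
  rw [add_eq_left, smul_eq_zero] at h0
  rcases h0 with h0 | h0
  · exact hk.ne' (by exact_mod_cast h0)
  · exact hS.ne_zero γ hγ h0

theorem IsMaximalIn.mem_pos {S : Finset V} (hS : IsReflectionClosed S) (hSΔ : S ⊆ ctx.Δ)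
    {μ : V} (hμ : ctx.IsMaximalIn S μ) : μ ∈ ctx.Pos := by
  rcases ctx.pos_or_neg μ (hSΔ hμ.1) with h | h
  · exact h
  · have h1 := hμ.inner_nonneg hS hSΔ (hS.neg_mem μ hμ.1) h
    rw [inner_neg_right] at h1
    have := real_inner_self_pos.mpr (hS.ne_zero μ hμ.1)
    linarith

theorem IsMaximalIn.mem_pos_of_inner_pos {S : Finset V} (hS : IsReflectionClosed S)
    (hSΔ : S ⊆ ctx.Δ) {μ : V} (hμ : ctx.IsMaximalIn S μ) {γ : V} (hγ : γ ∈ S)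
    (hpos : 0 < ⟪μ, γ⟫) : γ ∈ ctx.Pos := by
  refine (ctx.pos_or_neg γ (hSΔ hγ)).resolve_right fun h => ?_
  have h1 := hμ.inner_nonneg hS hSΔ (hS.neg_mem γ hγ) h
  rw [inner_neg_right] at h1
  linarith

/-- Two distinct roots with positive inner product differ by a root. -/
theorem sub_mem_of_inner_pos {S : Finset V} (hS : IsReflectionClosed S) (hSΔ : S ⊆ ctx.Δ)
    {μ ν : V} (hμ : μ ∈ S) (hν : ν ∈ S) (hpos : 0 < ⟪μ, ν⟫) (hne : μ ≠ ν) : μ - ν ∈ S := by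
  obtain ⟨a, ha⟩ := ctx.pairing_int ν (hSΔ hν) μ (hSΔ hμ)
  obtain ⟨b, hb⟩ := ctx.pairing_int μ (hSΔ hμ) ν (hSΔ hν)
  have hμμ := real_inner_self_pos.mpr (hS.ne_zero μ hμ)
  have hνν := real_inner_self_pos.mpr (hS.ne_zero ν hν)
  have ha' := cartanPairing_mul_inner_self (hS.ne_zero ν hν) μ
  have hb' := cartanPairing_mul_inner_self (hS.ne_zero μ hμ) ν
  rw [ha] at ha'
  rw [hb, real_inner_comm μ ν] at hb'
  have ha0 : 0 < a := by
    have : (0 : ℝ) < a := by by_contra! h; nlinarith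
    exact_mod_cast this
  have hb0 : 0 < b := by
    have : (0 : ℝ) < b := by by_contra! h; nlinarith
    exact_mod_cast this
  by_cases ha1 : a = 1
  · have := hS.reflection_mem ν hν μ hμ
    rwa [rootReflection, ha, ha1, Int.cast_one, one_smul] at this
  by_cases hb1 : b = 1
  · have := hS.neg_mem _ (hS.reflection_mem μ hμ ν hν)
    rwa [rootReflection, hb, hb1, Int.cast_one, one_smul, neg_sub] at this
  · exfalso
    have ha2 : (2 : ℝ) ≤ a := by exact_mod_cast (show 2 ≤ a by omega)
    have hb2 : (2 : ℝ) ≤ b := by exact_mod_cast (show 2 ≤ b by omega)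
    have hd := real_inner_self_pos.mpr (sub_ne_zero.mpr hne)
    rw [real_inner_sub_sub_self] at hd
    nlinarith

theorem IsMaximalIn.unique {S C : Finset V} (hS : IsReflectionClosed S) (hSΔ : S ⊆ ctx.Δ)
    (hC : IsComponent S C) {μ ν : V} (hμ : ctx.IsMaximalIn C μ) (hν : ctx.IsMaximalIn C ν) :
    μ = ν := by
  have hCr := hS.of_isComponent hC
  have hCΔ := hC.subset.trans hSΔ
  have hμpos := hμ.mem_pos hCr hCΔ
  have hνpos := hν.mem_pos hCr hCΔ
  have hinner : 0 < ⟪μ, ν⟫ := by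
    refine lt_of_le_of_ne (hμ.inner_nonneg hCr hCΔ hν.1 hνpos) fun h0 => ?_
    obtain ⟨δ, hδ, hδμ, hδν⟩ :=
      hS.exists_common_neighbour (hC.subset hμ.1) (hC.reflTransGen hμ.1 hν.1)
    have hδC : δ ∈ C := hC.mem_of_inner_ne_zero hμ.1 hδ (by rwa [real_inner_comm])
    obtain ⟨δ, hδC, hδpos, hδμ, hδν⟩ :
        ∃ δ ∈ C, δ ∈ ctx.Pos ∧ ⟪μ, δ⟫ ≠ 0 ∧ ⟪ν, δ⟫ ≠ 0 := by
      rw [real_inner_comm] at hδμ hδν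
      rcases ctx.pos_or_neg δ (hSΔ hδ) with h | h
      · exact ⟨δ, hδC, h, hδμ, hδν⟩
      · exact ⟨-δ, hCr.neg_mem δ hδC, h, by rwa [inner_neg_right, neg_ne_zero],
          by rwa [inner_neg_right, neg_ne_zero]⟩
    have h1 : 0 < ⟪μ, δ⟫ := lt_of_le_of_ne (hμ.inner_nonneg hCr hCΔ hδC hδpos) hδμ.symm
    have h2 : 0 < ⟪ν, δ⟫ := lt_of_le_of_ne (hν.inner_nonneg hCr hCΔ hδC hδpos) hδν.symm
    have hr := hCr.reflection_mem μ hμ.1 δ hδC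
    have h3 : ⟪ν, rootReflection μ δ⟫ = ⟪ν, δ⟫ := by
      rw [rootReflection, inner_sub_right, real_inner_smul_right, real_inner_comm μ ν, ← h0,
        mul_zero, sub_zero]
    have hrpos := hν.mem_pos_of_inner_pos hCr hCΔ hr (h3 ▸ h2)
    have h4 := hμ.inner_nonneg hCr hCΔ hr hrpos
    rw [real_inner_comm, inner_rootReflection_self (hCr.ne_zero μ hμ.1), real_inner_comm] at h4
    linarith
  by_contra hne
  have hsub := sub_mem_of_inner_pos hCr hCΔ hμ.1 hν.1 hinner hne
  rcases ctx.pos_or_neg _ (hCΔ hsub) with h | h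
  · exact hne (hν.2 μ hμ.1 (ctx.pos_coords _ h))
  · rw [neg_sub] at h
    exact hne (hμ.2 ν hν.1 (ctx.pos_coords _ h)).symm

theorem exists_isMaximalIn_ge {S : Finset V} {γ : V} (hγ : γ ∈ S) :
    ∃ μ, ctx.IsMaximalIn S μ ∧ ctx.rootLE γ μ := by
  have hγ' : γ ∈ S.filter fun μ => ctx.rootLE γ μ :=
    Finset.mem_filter.mpr ⟨hγ, by rw [rootLE, sub_self]; exact zero_mem _⟩
  obtain ⟨μ, hμ, hmax⟩ := Finset.exists_max_image _ (fun v => ctx.height v) ⟨γ, hγ'⟩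
  rw [Finset.mem_filter] at hμ
  refine ⟨μ, ⟨hμ.1, fun ν hν hle => ?_⟩, hμ.2⟩
  have hγν : ctx.rootLE γ ν := by
    have := add_mem hle hμ.2
    rwa [sub_add_sub_cancel] at this
  have hh := hmax ν (Finset.mem_filter.mpr ⟨hν, hγν⟩)
  refine sub_eq_zero.mp ((ctx.eq_zero_or_height_pos hle).resolve_right ?_)
  rw [map_sub]
  exact not_lt.mpr (sub_nonpos.mpr hh)

theorem exists_isHighest {S C : Finset V} (hS : IsReflectionClosed S) (hSΔ : S ⊆ ctx.Δ)
    (hC : IsComponent S C) (hne : C.Nonempty) : ∃ β, ctx.IsHighest C β := by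
  obtain ⟨γ₀, hγ₀⟩ := hne
  obtain ⟨μ, hμ, -⟩ := exists_isMaximalIn_ge (ctx := ctx) hγ₀
  refine ⟨μ, hμ.1, hμ.mem_pos (hS.of_isComponent hC) (hC.subset.trans hSΔ), fun γ hγ => ?_⟩
  obtain ⟨ν, hν, hle⟩ := exists_isMaximalIn_ge (ctx := ctx) hγ
  rwa [hμ.unique hS hSΔ hC hν]

theorem orthSub_subset {S : Finset V} {β : V} : orthSub S β ⊆ S := Finset.filter_subset _ _

theorem CascadeMem.spec {S : Finset V} {β : V} (h : ctx.CascadeMem S β) :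
    S ⊆ ctx.Δ ∧ IsReflectionClosed S ∧ ctx.IsHighest S β := by
  induction h with
  | top => exact ⟨subset_rfl, ctx.isReflectionClosed,
      ctx.pos_subset ctx.theta_mem, ctx.theta_mem, ctx.theta_highest⟩
  | step _ hC hβ ih =>
    exact ⟨(hC.subset.trans orthSub_subset).trans ih.1,
      (ih.2.1.orthSub _).of_isComponent hC, hβ⟩

/-- Every positive root in a cascade subsystem lies in the Heisenberg subset of some cascade
pair. -/
theorem CascadeMem.exists_inner_pos {S : Finset V} {β : V} (h : ctx.CascadeMem S β)
    {γ : V} (hγ : γ ∈ S) (hpos : γ ∈ ctx.Pos) :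
    ∃ S' β', ctx.CascadeMem S' β' ∧ γ ∈ S' ∧ 0 < ⟪γ, β'⟫ := by
  induction hn : S.card using Nat.strong_induction_on generalizing S β with
  | _ n ih =>
  obtain ⟨hSΔ, hS, hβ⟩ := h.spec
  have hnonneg := hβ.isMaximalIn.inner_nonneg hS hSΔ hγ hpos
  rw [real_inner_comm] at hnonneg
  rcases hnonneg.lt_or_eq with hlt | h0
  · exact ⟨S, β, h, hγ, hlt⟩
  · have hγo : γ ∈ orthSub S β := mem_orthSub.mpr ⟨hγ, h0.symm⟩
    have hC : IsComponent (orthSub S β) (component (orthSub S β) γ) := ⟨γ, hγo, rfl⟩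
    have hγC : γ ∈ component (orthSub S β) γ := mem_component.mpr ⟨hγo, .refl⟩
    obtain ⟨β', hβ'⟩ :=
      exists_isHighest (hS.orthSub β) (orthSub_subset.trans hSΔ) hC ⟨γ, hγC⟩
    have hlt : (component (orthSub S β) γ).card < S.card := by
      refine Finset.card_lt_card ((Finset.ssubset_iff_of_subset
        (hC.subset.trans orthSub_subset)).mpr ⟨β, hβ.1, fun hβC => ?_⟩)
      exact hS.ne_zero β hβ.1 (inner_self_eq_zero.mp (mem_orthSub.mp (hC.subset hβC)).2)
    exact ih _ (hn ▸ hlt) (h.step hC hβ') hγC rfl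

variable (ctx) in
/-- The cascade pairs of a given depth. -/
inductive CascadeAt : ℕ → Finset V → V → Prop
  | top : CascadeAt 0 ctx.Δ ctx.θ
  | step {n : ℕ} {S C : Finset V} {β β' : V} : CascadeAt n S β →
      IsComponent (orthSub S β) C → ctx.IsHighest C β' → CascadeAt (n + 1) C β'

theorem CascadeMem.exists_depth {S : Finset V} {β : V} (h : ctx.CascadeMem S β) :
    ∃ n, ctx.CascadeAt n S β := by
  induction h with
  | top => exact ⟨0, .top⟩
  | step _ hC hβ ih =>
    obtain ⟨n, hn⟩ := ih
    exact ⟨n + 1, hn.step hC hβ⟩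

theorem CascadeAt.isHighest {n : ℕ} {S : Finset V} {β : V} (h : ctx.CascadeAt n S β) :
    ctx.IsHighest S β := by
  cases h with
  | top => exact CascadeMem.top.spec.2.2
  | step _ _ hβ => exact hβ

theorem CascadeAt.eq_or_orthogonal {n : ℕ} {S S' : Finset V} {β β' : V}
    (h : ctx.CascadeAt n S β) (h' : ctx.CascadeAt n S' β') :
    (S = S' ∧ β = β') ∨ ∀ a ∈ S, ∀ b ∈ S', ⟪a, b⟫ = 0 := by
  induction n generalizing S S' β β' with
  | zero =>
    cases h
    cases h'
    exact Or.inl ⟨rfl, rfl⟩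
  | succ n ih =>
    cases h with
    | step h₁ hC hβ =>
    cases h' with
    | step h₁' hC' hβ' =>
    rcases ih h₁ h₁' with ⟨rfl, rfl⟩ | horth
    · rcases hC.eq_or_orthogonal hC' with rfl | h
      · exact Or.inl ⟨rfl, hβ.unique hβ'⟩
      · exact Or.inr h
    · exact Or.inr fun a ha b hb =>
        horth a (orthSub_subset (hC.subset ha)) b (orthSub_subset (hC'.subset hb))

theorem CascadeAt.exists_ancestor {m n : ℕ} (hnm : n ≤ m) {S : Finset V} {β : V}
    (h : ctx.CascadeAt m S β) :
    ∃ S' β', ctx.CascadeAt n S' β' ∧ ((n = m ∧ S = S' ∧ β = β') ∨ S ⊆ orthSub S' β') := by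
  induction h with
  | top =>
    obtain rfl : n = 0 := by omega
    exact ⟨_, _, .top, Or.inl ⟨rfl, rfl, rfl⟩⟩
  | @step m S C β β' h₁ hC hβ ih =>
    rcases Nat.lt_or_ge m n with hlt | hle
    · obtain rfl : n = m + 1 := by omega
      exact ⟨_, _, h₁.step hC hβ, Or.inl ⟨rfl, rfl, rfl⟩⟩
    · obtain ⟨S', β'', h', hor⟩ := ih hle
      refine ⟨S', β'', h', Or.inr ?_⟩
      rcases hor with ⟨-, rfl, rfl⟩ | hsub
      · exact hC.subset
      · exact (hC.subset.trans orthSub_subset).trans hsub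

/-- Relative position of a cascade subsystem and a cascade root. -/
theorem CascadeMem.mem_or_orthogonal {S S' : Finset V} {β β' : V} (h : ctx.CascadeMem S β)
    (h' : ctx.CascadeMem S' β') :
    (β' ∈ S ∧ (β' = β ∨ ⟪β', β⟫ = 0)) ∨ ∀ γ ∈ S, ⟪γ, β'⟫ = 0 := by
  obtain ⟨n, hn⟩ := h.exists_depth
  obtain ⟨m, hm⟩ := h'.exists_depth
  have hβ' := hm.isHighest.1
  rcases le_or_gt n m with hle | hlt
  · obtain ⟨T, δ, hT, hor⟩ := hm.exists_ancestor hle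
    rcases hn.eq_or_orthogonal hT with ⟨rfl, rfl⟩ | horth
    · rcases hor with ⟨-, rfl, rfl⟩ | hsub
      · exact Or.inl ⟨hβ', Or.inl rfl⟩
      · have := mem_orthSub.mp (hsub hβ')
        exact Or.inl ⟨this.1, Or.inr this.2⟩
    · refine Or.inr fun γ hγ => horth γ hγ β' ?_
      rcases hor with ⟨-, rfl, -⟩ | hsub
      · exact hβ'
      · exact orthSub_subset (hsub hβ')
  · obtain ⟨T, δ, hT, hor⟩ := hn.exists_ancestor hlt.le
    replace hor := hor.resolve_left fun hh => hlt.ne hh.1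
    rcases hm.eq_or_orthogonal hT with ⟨rfl, rfl⟩ | horth
    · exact Or.inr fun γ hγ => (mem_orthSub.mp (hor hγ)).2
    · refine Or.inr fun γ hγ => ?_
      rw [real_inner_comm]
      exact horth β' hβ' γ (orthSub_subset (hor hγ))

theorem IsCascade.orthogonal {K : Finset V} (hK : ctx.IsCascade K) :
    ∀ β ∈ K, ∀ β' ∈ K, β ≠ β' → ⟪β, β'⟫ = 0 := by
  intro β hβ β' hβ' hne
  obtain ⟨S, hS⟩ := (hK β).mp hβ
  obtain ⟨S', hS'⟩ := (hK β').mp hβ'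
  rcases hS.mem_or_orthogonal hS' with ⟨-, rfl | h⟩ | h
  · exact absurd rfl hne
  · rwa [real_inner_comm]
  · exact h β hS.spec.2.2.1

theorem IsCascade.theta_mem {K : Finset V} (hK : ctx.IsCascade K) : ctx.θ ∈ K :=
  (hK _).mpr ⟨_, .top⟩

theorem IsCascade.mem_pos {K : Finset V} (hK : ctx.IsCascade K) {β : V} (hβ : β ∈ K) :
    β ∈ ctx.Pos := by
  obtain ⟨S, hS⟩ := (hK β).mp hβ
  exact hS.spec.2.2.2.1

end RootSystemCtx

/-- The reflection in the span of pairwise orthogonal vectors, `v ↦ 2 proj v - v`. -/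
noncomputable def spanReflection {V : Type*} [NormedAddCommGroup V] [InnerProductSpace ℝ V]
    (K : Finset V) (v : V) : V := ∑ β ∈ K, cartanPairing v β • β - v

section SpanReflection

variable {V : Type*} [NormedAddCommGroup V] [InnerProductSpace ℝ V] {K : Finset V}

theorem spanReflection_add (v w : V) :
    spanReflection K (v + w) = spanReflection K v + spanReflection K w := by
  have h (β : V) : cartanPairing (v + w) β • β = cartanPairing v β • β + cartanPairing w β • β := by
    rw [← add_smul, cartanPairing, inner_add_left, mul_add, add_div, cartanPairing, cartanPairing]
  rw [spanReflection, Finset.sum_congr rfl fun β _ => h β, Finset.sum_add_distrib,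
    spanReflection, spanReflection]
  abel

theorem spanReflection_zero : spanReflection K (0 : V) = 0 := by
  simp [spanReflection, cartanPairing]

theorem inner_spanReflection (hK : ∀ β ∈ K, ∀ β' ∈ K, β ≠ β' → ⟪β, β'⟫ = 0) (v : V) {β : V}
    (hβ : β ∈ K) (h0 : β ≠ 0) : ⟪spanReflection K v, β⟫ = ⟪v, β⟫ := by
  rw [spanReflection, inner_sub_left, sum_inner, Finset.sum_eq_single_of_mem β hβ,
    real_inner_smul_left, cartanPairing_mul_inner_self h0]
  · ring
  · intro b hb hne
    rw [real_inner_smul_left, hK b hb β hβ hne, mul_zero]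

theorem spanReflection_spanReflection (hK : ∀ β ∈ K, ∀ β' ∈ K, β ≠ β' → ⟪β, β'⟫ = 0)
    (h0 : ∀ β ∈ K, β ≠ 0) (v : V) : spanReflection K (spanReflection K v) = v := by
  have h : ∀ β ∈ K, cartanPairing (spanReflection K v) β • β = cartanPairing v β • β :=
    fun β hβ => by
      rw [cartanPairing, inner_spanReflection hK v hβ (h0 β hβ), cartanPairing]
  rw [spanReflection, Finset.sum_congr rfl h]
  simp [spanReflection]

end SpanReflection

namespace RootSystemCtx

variable {V : Type*} [NormedAddCommGroup V] [InnerProductSpace ℝ V] {ctx : RootSystemCtx V}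

/-- The negative of the product of the cascade reflections preserves the positive roots. -/
theorem IsCascade.spanReflection_mem_pos {K : Finset V} (hK : ctx.IsCascade K) {γ : V}
    (hγ : γ ∈ ctx.Pos) : spanReflection K γ ∈ ctx.Pos := by
  obtain ⟨S, β, hSβ, hγS, hpos⟩ :=
    CascadeMem.top.exists_inner_pos (ctx.pos_subset hγ) hγ
  obtain ⟨hSΔ, hS, hβ⟩ := hSβ.spec
  have hmem : spanReflection K γ ∈ S := by
    have h := hS.neg_mem _ (hS.sub_sum_mem hK.orthogonal (fun β' hβ' => by
      obtain ⟨S', hS'⟩ := (hK β').mp hβ'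
      exact (hSβ.mem_or_orthogonal hS').imp_left And.left) hγS)
    rwa [neg_sub] at h
  refine hβ.isMaximalIn.mem_pos_of_inner_pos hS hSΔ hmem ?_
  rwa [real_inner_comm, inner_spanReflection hK.orthogonal γ ((hK β).mpr ⟨S, hSβ⟩)
    (hS.ne_zero β hβ.1)]

theorem IsCascade.spanReflection_mem_closure {K : Finset V} (hK : ctx.IsCascade K) {v : V}
    (hv : v ∈ AddSubmonoid.closure (ctx.base : Set V)) :
    spanReflection K v ∈ AddSubmonoid.closure (ctx.base : Set V) := by
  induction hv using AddSubmonoid.closure_induction with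
  | mem x hx => exact ctx.pos_coords _ (hK.spanReflection_mem_pos (ctx.base_subset hx))
  | zero => rw [spanReflection_zero]; exact zero_mem _
  | add x y _ _ hx hy => rw [spanReflection_add]; exact add_mem hx hy

theorem theta_inner_nonneg {γ : V} (hγ : γ ∈ ctx.Pos) : 0 ≤ ⟪ctx.θ, γ⟫ :=
  CascadeMem.top.spec.2.2.isMaximalIn.inner_nonneg ctx.isReflectionClosed subset_rfl
    (ctx.pos_subset hγ) hγ

/-- If `a` is the only simple root not orthogonal to `θ`, every nonnegative combination of
simple roots splits into a multiple of `a` and a part orthogonal to `θ`. -/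
theorem exists_eq_smul_add {a : V}
    (huniq : ∀ β ∈ ctx.base, ⟪ctx.θ, β⟫ ≠ 0 → β = a) {v : V}
    (hv : v ∈ AddSubmonoid.closure (ctx.base : Set V)) :
    ∃ n : ℕ, ∃ s ∈ AddSubmonoid.closure (ctx.base : Set V),
      v = (n : ℝ) • a + s ∧ ⟪ctx.θ, v⟫ = n * ⟪ctx.θ, a⟫ := by
  induction hv using AddSubmonoid.closure_induction with
  | mem x hx =>
    by_cases h : ⟪ctx.θ, x⟫ = 0
    · exact ⟨0, x, AddSubmonoid.subset_closure hx, by simp, by simp [h]⟩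
    · obtain rfl := huniq x hx h
      exact ⟨1, 0, zero_mem _, by simp, by simp⟩
  | zero => exact ⟨0, 0, zero_mem _, by simp, by simp⟩
  | add x y _ _ hx hy =>
    obtain ⟨n, s, hs, hx, hx'⟩ := hx
    obtain ⟨m, t, ht, hy, hy'⟩ := hy
    refine ⟨n + m, s + t, add_mem hs ht, ?_, ?_⟩
    · rw [hx, hy]
      push_cast
      module
    · rw [inner_add_right, hx', hy']
      push_cast
      ring

theorem exists_eq_add_of_inner_eq {a : V} (hne : ⟪ctx.θ, a⟫ ≠ 0)
    (huniq : ∀ β ∈ ctx.base, ⟪ctx.θ, β⟫ ≠ 0 → β = a) {v : V}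
    (hv : v ∈ AddSubmonoid.closure (ctx.base : Set V)) (h : ⟪ctx.θ, v⟫ = ⟪ctx.θ, a⟫) :
    ∃ s ∈ AddSubmonoid.closure (ctx.base : Set V), v = a + s := by
  obtain ⟨n, s, hs, hvs, hn⟩ := exists_eq_smul_add huniq hv
  have hn1 : (n : ℝ) = 1 := mul_right_cancel₀ hne (by rw [← hn, h, one_mul])
  exact ⟨s, hs, by rw [hvs, hn1, one_smul]⟩

theorem IsCascade.spanReflection_eq_self {K : Finset V} (hK : ctx.IsCascade K) {a : V}
    (ha : a ∈ ctx.base) (hne : ⟪ctx.θ, a⟫ ≠ 0)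
    (huniq : ∀ β ∈ ctx.base, ⟪ctx.θ, β⟫ ≠ 0 → β = a) : spanReflection K a = a := by
  have h0 : ∀ β ∈ K, β ≠ 0 := fun β hβ => ctx.ne_zero_of_mem_pos (hK.mem_pos hβ)
  have hmem := ctx.pos_coords _ (hK.spanReflection_mem_pos (ctx.base_subset ha))
  have hinner : ⟪ctx.θ, spanReflection K a⟫ = ⟪ctx.θ, a⟫ := by
    rw [real_inner_comm, inner_spanReflection hK.orthogonal a hK.theta_mem (h0 _ hK.theta_mem),
      real_inner_comm]
  obtain ⟨s, hs, hsa⟩ := exists_eq_add_of_inner_eq hne huniq hmem hinner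
  have hinv := spanReflection_spanReflection hK.orthogonal h0 a
  rw [hsa, spanReflection_add, hsa, add_assoc, add_eq_left] at hinv
  have hs0 : s = 0 := ctx.eq_zero_of_neg_mem_closure hs
    (by rw [neg_eq_of_add_eq_zero_right hinv]; exact hK.spanReflection_mem_closure hs)
  rw [hsa, hs0, add_zero]

/-- The highest root is the only root whose inner product with `θ` is `(θ, θ)`. -/
theorem eq_theta_of_inner_eq {γ : V} (hγ : γ ∈ ctx.Δ) (h : ⟪ctx.θ, γ⟫ = ⟪ctx.θ, ctx.θ⟫) :
    γ = ctx.θ := by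
  have hθ := ctx.ne_zero_of_mem_pos ctx.theta_mem
  have hr := ctx.theta_highest _
    (ctx.neg_mem _ (ctx.reflect_mem ctx.θ (ctx.pos_subset ctx.theta_mem) γ hγ))
  have hc : cartanPairing γ ctx.θ = 2 := by
    rw [cartanPairing, real_inner_comm, h, mul_div_assoc,
      div_self (inner_self_ne_zero.mpr hθ), mul_one]
  rw [hc] at hr
  refine ctx.rootLE_antisymm (ctx.theta_highest γ hγ) ?_
  have hsub : ctx.θ - -(γ - (2 : ℝ) • ctx.θ) = γ - ctx.θ := by module
  rwa [hsub] at hr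

theorem theta_inner_le {γ : V} (hγ : γ ∈ ctx.Δ) : ⟪ctx.θ, γ⟫ ≤ ⟪ctx.θ, ctx.θ⟫ := by
  suffices h : ∀ v ∈ AddSubmonoid.closure (ctx.base : Set V), 0 ≤ ⟪ctx.θ, v⟫ by
    have := h _ (ctx.theta_highest γ hγ)
    rw [inner_sub_right] at this
    linarith
  intro v hv
  induction hv using AddSubmonoid.closure_induction with
  | mem x hx => exact theta_inner_nonneg (ctx.base_subset hx)
  | zero => simp
  | add x y _ _ hx hy => rw [inner_add_right]; exact add_nonneg hx hy

theorem inner_self_eq_of_pairing_eq_one {a : V} (ha : a ∈ ctx.base)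
    (hpair : cartanPairing ctx.θ a = 1)
    (huniq : ∀ β ∈ ctx.base, ⟪ctx.θ, β⟫ ≠ 0 → β = a) :
    ⟪a, a⟫ = ⟪ctx.θ, ctx.θ⟫ ∧ 2 * ⟪ctx.θ, a⟫ = ⟪ctx.θ, ctx.θ⟫ := by
  have hapos := ctx.base_subset ha
  have hθ := ctx.ne_zero_of_mem_pos ctx.theta_mem
  have ha0 := ctx.ne_zero_of_mem_pos hapos
  have hθθ := real_inner_self_pos.mpr hθ
  have haa := real_inner_self_pos.mpr ha0
  have h1 := cartanPairing_mul_inner_self ha0 ctx.θ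
  rw [hpair, one_mul] at h1
  obtain ⟨n, s, -, -, hn⟩ := exists_eq_smul_add huniq (ctx.pos_coords _ ctx.theta_mem)
  obtain ⟨m, hm⟩ := ctx.pairing_int ctx.θ (ctx.pos_subset ctx.theta_mem) a (ctx.pos_subset hapos)
  have h2 := cartanPairing_mul_inner_self hθ a
  rw [hm, real_inner_comm ctx.θ a] at h2
  have hnm : (n : ℝ) * m = 2 := by
    have : ((n : ℝ) * m - 2) * ⟪ctx.θ, ctx.θ⟫ = 0 := by linear_combination (n : ℝ) * h2 - 2 * hn
    linarith [(mul_eq_zero.mp this).resolve_right hθθ.ne']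
  have hnm' : (n : ℤ) * m = 2 := by exact_mod_cast hnm
  have hm0 : 0 < m := by
    have : (0 : ℝ) < m := by by_contra! h; nlinarith
    exact_mod_cast this
  have hm2 : m ≤ 2 := Int.le_of_dvd two_pos ⟨n, by linarith⟩
  have hm_ne : m ≠ 2 := by
    rintro rfl
    push_cast at h2
    have := eq_theta_of_inner_eq (ctx.pos_subset hapos) (by linarith)
    rw [this] at h1
    linarith
  obtain rfl : m = 1 := by omega
  push_cast at h2
  exact ⟨by linarith, by linarith⟩

/-- Positive roots orthogonal to `θ` have nonpositive inner product with the simple root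
attached to `θ`. -/
theorem inner_nonpos_of_orthogonal_theta {a : V} (ha : a ∈ ctx.base) (hne : ⟪ctx.θ, a⟫ ≠ 0)
    (huniq : ∀ β ∈ ctx.base, ⟪ctx.θ, β⟫ ≠ 0 → β = a) {β : V} (hβ : β ∈ ctx.Pos)
    (horth : ⟪ctx.θ, β⟫ = 0) : ⟪a, β⟫ ≤ 0 := by
  by_contra! hpos
  have haΔ := ctx.pos_subset (ctx.base_subset ha)
  have hβΔ := ctx.pos_subset hβ
  obtain ⟨k, hk, hrefl⟩ := ctx.exists_reflection_eq_add (ctx.neg_mem β hβΔ) haΔ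
    (by rw [inner_neg_right]; linarith)
  have hmem := ctx.isReflectionClosed.reflection_mem _ (ctx.neg_mem β hβΔ) a haΔ
  have hinner : ⟪ctx.θ, rootReflection (-β) a⟫ = ⟪ctx.θ, a⟫ := by
    rw [hrefl, inner_add_right, real_inner_smul_right, inner_neg_right, horth]
    ring
  have hθa : 0 < ⟪ctx.θ, a⟫ :=
    lt_of_le_of_ne (theta_inner_nonneg (ctx.base_subset ha)) hne.symm
  have hmempos := CascadeMem.top.spec.2.2.isMaximalIn.mem_pos_of_inner_pos
    ctx.isReflectionClosed subset_rfl hmem (hinner ▸ hθa)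
  obtain ⟨s, hs, hsa⟩ := exists_eq_add_of_inner_eq hne huniq (ctx.pos_coords _ hmempos) hinner
  rw [hrefl, add_right_inj] at hsa
  have h0 := ctx.eq_zero_of_neg_mem_closure hs (by
    rw [← hsa, smul_neg, neg_neg]
    exact ctx.natCast_smul_mem_closure k (ctx.pos_coords _ hβ))
  rw [h0, smul_neg, neg_eq_zero, smul_eq_zero] at hsa
  rcases hsa with h | h
  · exact hk.ne' (by exact_mod_cast h)
  · exact ctx.ne_zero_of_mem_pos hβ h

/-- A positive root orthogonal to `θ` is orthogonal to the simple root `a` attached to `θ`, or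
pairs to `-1` with its coroot. -/
theorem inner_eq_zero_or_eq_neg_half {a : V} (ha : a ∈ ctx.base)
    (hpair : cartanPairing ctx.θ a = 1) (hne : ⟪ctx.θ, a⟫ ≠ 0)
    (huniq : ∀ β ∈ ctx.base, ⟪ctx.θ, β⟫ ≠ 0 → β = a) {β : V} (hβ : β ∈ ctx.Pos)
    (horth : ⟪ctx.θ, β⟫ = 0) : ⟪a, β⟫ = 0 ∨ 2 * ⟪a, β⟫ = -⟪a, a⟫ := by
  obtain ⟨haa, hθa⟩ := inner_self_eq_of_pairing_eq_one ha hpair huniq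
  have haΔ := ctx.pos_subset (ctx.base_subset ha)
  have ha0 := ctx.ne_zero_of_mem_pos (ctx.base_subset ha)
  have hL := real_inner_self_pos.mpr ha0
  rcases (inner_nonpos_of_orthogonal_theta ha hne huniq hβ horth).eq_or_lt with h | hlt
  · exact Or.inl h
  right
  obtain ⟨k, hk, hrefl⟩ := ctx.exists_reflection_eq_add haΔ (ctx.pos_subset hβ)
    (by rwa [real_inner_comm])
  have hmem := ctx.isReflectionClosed.reflection_mem _ haΔ β (ctx.pos_subset hβ)
  have hself := inner_rootReflection_self ha0 β
  rw [hrefl, inner_add_left, real_inner_smul_left, real_inner_comm a β] at hself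
  have hθr : ⟪ctx.θ, rootReflection a β⟫ = k * ⟪ctx.θ, a⟫ := by
    rw [hrefl, inner_add_right, real_inner_smul_right, horth, zero_add]
  have hle := theta_inner_le hmem
  rw [hθr] at hle
  have hk2 : k ≤ 2 := by
    have : (k : ℝ) ≤ 2 := by by_contra! h; nlinarith
    exact_mod_cast this
  have hk_ne : k ≠ 2 := by
    rintro rfl
    push_cast at hθr hself hrefl
    have h := eq_theta_of_inner_eq hmem (by linarith)
    rw [hrefl] at h
    have h' : ⟪β + (2 : ℝ) • a, a⟫ = ⟪ctx.θ, a⟫ := by rw [h]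
    rw [inner_add_left, real_inner_smul_left, real_inner_comm a β] at h'
    linarith
  obtain rfl : k = 1 := by omega
  push_cast at hself
  linarith

theorem IsCascade.inner_cascElt_theta {K : Finset V} (hK : ctx.IsCascade K) :
    ⟪ctx.θ, cascElt K⟫ = 1 := by
  rw [cascElt, inner_sum, Finset.sum_eq_single_of_mem ctx.θ hK.theta_mem]
  · rw [real_inner_smul_right]
    exact inv_mul_cancel₀ (inner_self_ne_zero.mpr (ctx.ne_zero_of_mem_pos ctx.theta_mem))
  · intro β hβ hne
    rw [real_inner_smul_right, hK.orthogonal _ hK.theta_mem β hβ hne.symm, mul_zero]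

/-- The simple root attached to a fundamental highest root takes the value `-1` at the cascade
element. -/
theorem IsCascade.inner_cascElt_eq_neg_one {K : Finset V} (hK : ctx.IsCascade K) {a : V}
    (ha : a ∈ ctx.base) (hpair : cartanPairing ctx.θ a = 1) (hne : ⟪ctx.θ, a⟫ ≠ 0)
    (huniq : ∀ β ∈ ctx.base, ⟪ctx.θ, β⟫ ≠ 0 → β = a) : ⟪a, cascElt K⟫ = -1 := by
  obtain ⟨haa, hθa⟩ := inner_self_eq_of_pairing_eq_one ha hpair huniq
  have hL := real_inner_self_pos.mpr (ctx.ne_zero_of_mem_pos (ctx.base_subset ha))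
  have hparseval : ∑ β ∈ K, cartanPairing a β * ⟪a, β⟫ = 2 * ⟪a, a⟫ := by
    have h := congrArg (fun v => ⟪a, v⟫) (hK.spanReflection_eq_self ha hne huniq)
    simp only [spanReflection, inner_sub_right, inner_sum, real_inner_smul_right] at h
    linarith
  have hcasc : ⟪a, cascElt K⟫ = ∑ β ∈ K, cartanPairing a β / 2 := by
    rw [cascElt, inner_sum]
    refine Finset.sum_congr rfl fun β _ => ?_
    rw [real_inner_smul_right, cartanPairing]
    ring
  have hθpair : cartanPairing a ctx.θ = 1 := by
    rw [cartanPairing, real_inner_comm, hθa, ← haa, div_self hL.ne']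
  rw [← Finset.add_sum_erase K _ hK.theta_mem, hθpair] at hparseval hcasc
  have hrest : ∑ β ∈ K.erase ctx.θ, cartanPairing a β * ⟪a, β⟫ =
      -⟪a, a⟫ * ∑ β ∈ K.erase ctx.θ, cartanPairing a β / 2 := by
    rw [Finset.mul_sum]
    refine Finset.sum_congr rfl fun β hβ => ?_
    obtain ⟨hβne, hβK⟩ := Finset.mem_erase.mp hβ
    rcases inner_eq_zero_or_eq_neg_half ha hpair hne huniq (hK.mem_pos hβK)
      (hK.orthogonal _ hK.theta_mem β hβK hβne.symm) with h | h
    · simp [cartanPairing, h]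
    · linear_combination cartanPairing a β / 2 * h
  rw [hrest, real_inner_comm] at hparseval
  rw [hcasc]
  refine mul_left_cancel₀ hL.ne' ?_
  linarith

end RootSystemCtx

/-- If the highest root `θ` is a fundamental weight and `α̃` is the unique simple root not
orthogonal to `θ`, then `α̃(x_K) = -1` and `(θ - α̃)(x_K) = 2`; in particular the cascade
element `x_K` is not dominant. -/
theorem casc_not_dominant {V : Type*} [NormedAddCommGroup V] [InnerProductSpace ℝ V]
    [FiniteDimensional ℝ V] (ctx : RootSystemCtx V)
    (K : Finset V) (hK : ctx.IsCascade K)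
    (hfund : ctx.ThetaFundamental)
    (atil : V) (hmem : atil ∈ ctx.base) (hne : ⟪ctx.θ, atil⟫ ≠ 0)
    (huniq : ∀ β ∈ ctx.base, ⟪ctx.θ, β⟫ ≠ 0 → β = atil) :
    ⟪atil, cascElt K⟫ = -1 ∧ ⟪ctx.θ - atil, cascElt K⟫ = 2 ∧
      ¬ (∀ γ ∈ ctx.Pos, 0 ≤ ⟪γ, cascElt K⟫) := by
  have ha : ⟪atil, cascElt K⟫ = -1 := by
    obtain ⟨α, hα, hpair, -⟩ := hfund
    have hαne : ⟪ctx.θ, α⟫ ≠ 0 := fun h => by simp [cartanPairing, h] at hpair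
    obtain rfl := huniq α hα hαne
    exact hK.inner_cascElt_eq_neg_one hmem hpair hne huniq
  refine ⟨ha, ?_, fun hdom => ?_⟩
  · rw [inner_sub_left, hK.inner_cascElt_theta, ha]
    norm_num
  · have := hdom atil (ctx.base_subset hmem)
    linarith
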